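/- Let c(n) (resp. c'(n)) be the number of ≡_{1,2}-equivalence (resp. ≡_{4,5}-equivalence) classes of binary trees of arity n. Then, as formal power series, (1 − 2t) · ∑_{n≥1} c(n) t^n = t(1 − t) and (1 − 2t) · ∑_{n≥1} c'(n) t^n = t(1 − t); i.e., the Hilbert series of the quotient operads Mag^{{1,2}} and Mag^{{4,5}} both equal t(1 − t)/(1 − 2t). -/

import Mathlib

/-- A binary tree: either a leaf or an ordered pair of binary trees. -/
inductive BTree : Type
  | leaf : BTree
  | node : BTree → BTree → BTree
  deriving DecidableEq

namespace BTree

/-- The arity of a binary tree is its number of leaves. -/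
def arity : BTree → ℕ
  | leaf => 1
  | node l r => arity l + arity r

/-- The degree of a binary tree is its number of internal nodes. -/
def degree : BTree → ℕ
  | leaf => 0
  | node l r => degree l + degree r + 1

/-- Grafting `t ∘ᵢ s`: identify the root of `s` with the `i`-th leaf of `t`
(leaves numbered from left to right, starting at `1`). -/
def graft : BTree → ℕ → BTree → BTree
  | leaf, i, s => if i = 1 then s else leaf
  | node l r, i, s =>
      if i ≤ l.arity then node (l.graft i s) r else node l (r.graft (i - l.arity) s)

/-- Simultaneous grafting `s ∘ [r_1, …, r_n]`: graft the `i`-th element of the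
list onto the `i`-th leaf of `s`, simultaneously. -/
def multigraft : BTree → List BTree → BTree
  | leaf, rs => rs.headD leaf
  | node l r, rs => node (l.multigraft (rs.take l.arity)) (r.multigraft (rs.drop l.arity))

/-- The left comb with `γ` internal nodes. -/
def leftComb : ℕ → BTree
  | 0 => leaf
  | γ + 1 => node (leftComb γ) leaf

/-- The right comb with `γ` internal nodes. -/
def rightComb : ℕ → BTree
  | 0 => leaf
  | γ + 1 => node leaf (rightComb γ)

/-- The prefix word of a binary tree, over the alphabet `{0, 2}`:
a left-to-right depth-first traversal writes `2` for each internal node and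
`0` for each leaf. -/
def prefixWord : BTree → List ℕ
  | leaf => [0]
  | node l r => 2 :: (prefixWord l ++ prefixWord r)

/-- The left rank: number of internal nodes on the leftmost branch from the root. -/
def leftRank : BTree → ℕ
  | leaf => 0
  | node l _ => leftRank l + 1

/-- The mirror of a binary tree. -/
def mirror : BTree → BTree
  | leaf => leaf
  | node l r => node (mirror r) (mirror l)

end BTree

/-- One step of the rewrite relation induced by a set of rewrite rules `R`:
`r ∘ᵢ (s ∘ [r_1, …, r_n]) ⇒ r ∘ᵢ (s' ∘ [r_1, …, r_n])` whenever `R s s'`. -/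
def Step (R : BTree → BTree → Prop) (t t' : BTree) : Prop :=
  ∃ (s s' r : BTree) (i : ℕ) (rs : List BTree),
    R s s' ∧ 1 ≤ i ∧ i ≤ r.arity ∧ rs.length = s.arity ∧
    t = r.graft i (s.multigraft rs) ∧ t' = r.graft i (s'.multigraft rs)

/-- The congruence generated by a set of rewrite rules: the reflexive–symmetric–transitive
closure of the induced rewrite relation. -/
def CongrGen (R : BTree → BTree → Prop) : BTree → BTree → Prop :=
  Relation.EqvGen (Step R)

/-- The tree `s` occurs as a subtree of `t`. -/
def Occurs (s t : BTree) : Prop :=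
  ∃ (r : BTree) (i : ℕ) (rs : List BTree),
    1 ≤ i ∧ i ≤ r.arity ∧ rs.length = s.arity ∧ t = r.graft i (s.multigraft rs)

/-- The rewrite relation induced by `R` is terminating: there is no infinite
chain `t_0 ⇒ t_1 ⇒ t_2 ⇒ ⋯`. -/
def Terminating (R : BTree → BTree → Prop) : Prop :=
  ¬ ∃ f : ℕ → BTree, ∀ n, Step R (f n) (f (n + 1))

/-- The rewrite relation induced by `R` is confluent. -/
def Confluent (R : BTree → BTree → Prop) : Prop :=
  ∀ t s₁ s₂, Relation.ReflTransGen (Step R) t s₁ → Relation.ReflTransGen (Step R) t s₂ →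
    ∃ t', Relation.ReflTransGen (Step R) s₁ t' ∧ Relation.ReflTransGen (Step R) s₂ t'

/-- The number of equivalence classes of binary trees of arity `n` under the
equivalence relation `E`. -/
noncomputable def classCount (E : BTree → BTree → Prop) (n : ℕ) : ℕ :=
  Nat.card (Quot fun a b : {t : BTree // t.arity = n} => E a.1 b.1)

/-- The congruence `≡_γ` generated by the single rewrite rule `(L_γ, R_γ)`. -/
def CAsCongr (γ : ℕ) : BTree → BTree → Prop :=
  CongrGen fun s s' => s = BTree.leftComb γ ∧ s' = BTree.rightComb γ

/-- The five binary trees of degree `3`, in increasing lexicographic order of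
their prefix words: `cubic 1` has prefix word `2020200` (the right comb), …,
`cubic 5` has prefix word `2220000` (the left comb). -/
def cubic : ℕ → BTree
  | 1 => .node .leaf (.node .leaf (.node .leaf .leaf))
  | 2 => .node .leaf (.node (.node .leaf .leaf) .leaf)
  | 3 => .node (.node .leaf .leaf) (.node .leaf .leaf)
  | 4 => .node (.node .leaf (.node .leaf .leaf)) .leaf
  | 5 => .node (.node (.node .leaf .leaf) .leaf) .leaf
  | _ => .leaf

/-- The congruence `≡_{i,j}` generated by the single rewrite rule `(𝔞_i, 𝔞_j)`. -/
def MagCongr (i j : ℕ) : BTree → BTree → Prop :=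
  CongrGen fun s s' => s = cubic i ∧ s' = cubic j

namespace BTree

/-- The arities of the right subtrees hanging off the leftmost branch, from bottom to top. -/
def spineArities : BTree → List ℕ
  | leaf => []
  | node l r => spineArities l ++ [arity r]

/-- The tree whose leftmost branch carries right combs with the prescribed arities. -/
def ofSpineArities (ks : List ℕ) : BTree :=
  ks.foldl (fun t k => node t (rightComb (k - 1))) leaf

theorem arity_pos (t : BTree) : 0 < t.arity := by
  induction t with
  | leaf => simp [arity]
  | node l r ihl ihr => simp only [arity]; omega

theorem arity_rightComb (k : ℕ) : (rightComb k).arity = k + 1 := by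
  induction k with
  | zero => rfl
  | succ k ih => simp only [rightComb, arity, ih]; omega

theorem mirror_mirror (t : BTree) : t.mirror.mirror = t := by
  induction t with
  | leaf => rfl
  | node l r ihl ihr => simp only [mirror, ihl, ihr]

theorem arity_mirror (t : BTree) : t.mirror.arity = t.arity := by
  induction t with
  | leaf => rfl
  | node l r ihl ihr => simp only [mirror, arity, ihl, ihr]; omega

theorem spineArities_sum (t : BTree) : t.spineArities.sum + 1 = t.arity := by
  induction t with
  | leaf => rfl
  | node l r ihl ihr =>
    simp only [spineArities, arity, List.sum_append, List.sum_singleton]; omega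

theorem spineArities_pos (t : BTree) : ∀ k ∈ t.spineArities, 0 < k := by
  induction t with
  | leaf => simp [spineArities]
  | node l r ihl ihr =>
    intro k hk
    simp only [spineArities, List.mem_append, List.mem_singleton] at hk
    rcases hk with hk | rfl
    · exact ihl k hk
    · exact arity_pos r

theorem spineArities_ofSpineArities (ks : List ℕ) (h : ∀ k ∈ ks, 0 < k) :
    (ofSpineArities ks).spineArities = ks := by
  induction ks using List.reverseRecOn with
  | nil => rfl
  | append_singleton ks k ih =>
    have hk : 0 < k := h k (by simp)
    have ih' := ih fun j hj => h j (by simp [hj])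
    simp only [ofSpineArities] at ih'
    simp only [ofSpineArities, List.foldl_append, List.foldl_cons, List.foldl_nil, spineArities,
      ih', arity_rightComb, Nat.sub_add_cancel hk]

end BTree

open BTree

/-- A reflexive relation compatible with `node` contains every rewrite relation whose
root instances it contains. -/
theorem Step.rel_of_root {R E : BTree → BTree → Prop} (hrefl : ∀ t, E t t)
    (hleft : ∀ a b c, E a b → E (node a c) (node b c))
    (hright : ∀ a b c, E a b → E (node c a) (node c b))
    (hroot : ∀ s s' rs, R s s' → rs.length = s.arity → E (s.multigraft rs) (s'.multigraft rs))
    {t t' : BTree} (h : Step R t t') : E t t' := by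
  obtain ⟨s, s', r, i, rs, hR, -, -, hlen, rfl, rfl⟩ := h
  have hs := hroot s s' rs hR hlen
  induction r generalizing i with
  | leaf =>
    simp only [graft]
    split_ifs
    · exact hs
    · exact hrefl _
  | node l r ihl ihr =>
    simp only [graft]
    split_ifs
    · exact hleft _ _ _ (ihl i)
    · exact hright _ _ _ (ihr _)

theorem Step.node_left {R : BTree → BTree → Prop} {a b : BTree} (c : BTree) (h : Step R a b) :
    Step R (node a c) (node b c) := by
  obtain ⟨s, s', r, i, rs, hR, hi, hir, hlen, rfl, rfl⟩ := h
  exact ⟨s, s', node r c, i, rs, hR, hi, by simp only [arity]; omega, hlen,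
    by simp [graft, hir], by simp [graft, hir]⟩

theorem Step.node_right {R : BTree → BTree → Prop} {a b : BTree} (c : BTree) (h : Step R a b) :
    Step R (node c a) (node c b) := by
  obtain ⟨s, s', r, i, rs, hR, hi, hir, hlen, rfl, rfl⟩ := h
  have hlt : ¬ i + c.arity ≤ c.arity := by omega
  exact ⟨s, s', node c r, i + c.arity, rs, hR, by omega, by simp only [arity]; omega, hlen,
    by simp only [graft, if_neg hlt, Nat.add_sub_cancel],
    by simp only [graft, if_neg hlt, Nat.add_sub_cancel]⟩

theorem Step.root {R : BTree → BTree → Prop} {s s' : BTree} (h : R s s') (rs : List BTree)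
    (hlen : rs.length = s.arity) : Step R (s.multigraft rs) (s'.multigraft rs) :=
  ⟨s, s', leaf, 1, rs, h, le_rfl, le_rfl, hlen, by simp [graft], by simp [graft]⟩

theorem CongrGen.equivalence (R : BTree → BTree → Prop) : Equivalence (CongrGen R) :=
  Relation.EqvGen.is_equivalence _

theorem CongrGen.map {R E : BTree → BTree → Prop} (hE : Equivalence E) {f : BTree → BTree}
    (hf : ∀ a b, Step R a b → E (f a) (f b)) {a b : BTree} (h : CongrGen R a b) :
    E (f a) (f b) := by
  induction h with
  | rel a b h => exact hf a b h
  | refl a => exact hE.refl _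
  | symm a b _ ih => exact hE.symm ih
  | trans a b c _ _ ih₁ ih₂ => exact hE.trans ih₁ ih₂

theorem CongrGen.node {R : BTree → BTree → Prop} {a a' b b' : BTree} (ha : CongrGen R a a')
    (hb : CongrGen R b b') : CongrGen R (node a b) (node a' b') :=
  (equivalence R).trans
    (ha.map (f := fun t => .node t b) (equivalence R)
      fun _ _ h => Relation.EqvGen.rel _ _ (h.node_left b))
    (hb.map (f := fun t => .node a' t) (equivalence R)
      fun _ _ h => Relation.EqvGen.rel _ _ (h.node_right a'))

theorem rel_node_node_rightComb {E : BTree → BTree → Prop} (hE : Equivalence E)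
    (hnode : ∀ a a' b b', E a a' → E b b' → E (node a b) (node a' b'))
    (hassoc : ∀ x y z w, E (node x (node y (node z w))) (node x (node (node y z) w)))
    (x t : BTree) (k : ℕ) :
    E (node x (node t (rightComb k))) (node x (rightComb (t.arity + k))) := by
  induction t generalizing x k with
  | leaf =>
    rw [arity, Nat.add_comm]
    exact hE.refl _
  | node p q ihp ihq =>
    have hq := hnode _ _ _ _ (hE.refl x) (ihq p k)
    have hp := ihp x (q.arity + k)
    rw [← Nat.add_assoc] at hp
    exact hE.trans (hE.symm (hassoc x p q _)) (hE.trans hq hp)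

theorem rel_node_rightComb {E : BTree → BTree → Prop} (hE : Equivalence E)
    (hnode : ∀ a a' b b', E a a' → E b b' → E (node a b) (node a' b'))
    (hassoc : ∀ x y z w, E (node x (node y (node z w))) (node x (node (node y z) w)))
    (x t : BTree) : E (node x t) (node x (rightComb (t.arity - 1))) := by
  induction t generalizing x with
  | leaf => exact hE.refl _
  | node p q _ ihq =>
    have h := rel_node_node_rightComb hE hnode hassoc x p (q.arity - 1)
    rw [← Nat.add_sub_assoc (arity_pos q)] at h
    exact hE.trans (hnode _ _ _ _ (hE.refl x) (ihq p)) h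

theorem rel_ofSpineArities {E : BTree → BTree → Prop} (hE : Equivalence E)
    (hnode : ∀ a a' b b', E a a' → E b b' → E (node a b) (node a' b'))
    (hassoc : ∀ x y z w, E (node x (node y (node z w))) (node x (node (node y z) w)))
    (t : BTree) : E t (ofSpineArities t.spineArities) := by
  induction t with
  | leaf => exact hE.refl _
  | node l r ihl _ =>
    have h := hnode _ _ _ _ ihl (hE.refl (rightComb (r.arity - 1)))
    simp only [ofSpineArities] at h
    simp only [ofSpineArities, spineArities, List.foldl_append, List.foldl_cons, List.foldl_nil]
    exact hE.trans (rel_node_rightComb hE hnode hassoc l r) h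

theorem rel_iff_spineArities_eq {E : BTree → BTree → Prop} (hE : Equivalence E)
    (hnode : ∀ a a' b b', E a a' → E b b' → E (node a b) (node a' b'))
    (hassoc : ∀ x y z w, E (node x (node y (node z w))) (node x (node (node y z) w)))
    (hinv : ∀ a b, E a b → a.spineArities = b.spineArities) (a b : BTree) :
    E a b ↔ a.spineArities = b.spineArities := by
  refine ⟨hinv a b, fun h => ?_⟩
  have hb := rel_ofSpineArities hE hnode hassoc b
  rw [← h] at hb
  exact hE.trans (rel_ofSpineArities hE hnode hassoc a) (hE.symm hb)

theorem exists_four_of_length {rs : List BTree} (h : rs.length = 4) :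
    ∃ x y z w, rs = [x, y, z, w] := by
  match rs, h with
  | [x, y, z, w], _ => exact ⟨x, y, z, w, rfl⟩

theorem CongrGen.spineArities_eq {R : BTree → BTree → Prop}
    (hroot : ∀ s s' rs, R s s' → rs.length = s.arity →
      (s.multigraft rs).arity = (s'.multigraft rs).arity ∧
        (s.multigraft rs).spineArities = (s'.multigraft rs).spineArities)
    {a b : BTree} (h : CongrGen R a b) : a.spineArities = b.spineArities := by
  let E : BTree → BTree → Prop := fun a b =>
    a.arity = b.arity ∧ a.spineArities = b.spineArities
  have hE : Equivalence E := ⟨fun _ => ⟨rfl, rfl⟩, fun h => ⟨h.1.symm, h.2.symm⟩,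
    fun h h' => ⟨h.1.trans h'.1, h.2.trans h'.2⟩⟩
  refine (h.map (f := id) hE fun a b hab => hab.rel_of_root hE.refl ?_ ?_ hroot).2
  · rintro a b c ⟨h₁, h₂⟩
    exact ⟨by simp only [arity, h₁], by simp only [spineArities, h₂]⟩
  · rintro a b c ⟨h₁, -⟩
    exact ⟨by simp only [arity, h₁], by simp only [spineArities, h₁]⟩

theorem CongrGen.spineArities_mirror_eq {R : BTree → BTree → Prop}
    (hroot : ∀ s s' rs, R s s' → rs.length = s.arity →
      (s.multigraft rs).arity = (s'.multigraft rs).arity ∧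
        (s.multigraft rs).mirror.spineArities = (s'.multigraft rs).mirror.spineArities)
    {a b : BTree} (h : CongrGen R a b) : a.mirror.spineArities = b.mirror.spineArities := by
  let E : BTree → BTree → Prop := fun a b =>
    a.arity = b.arity ∧ a.mirror.spineArities = b.mirror.spineArities
  have hE : Equivalence E := ⟨fun _ => ⟨rfl, rfl⟩, fun h => ⟨h.1.symm, h.2.symm⟩,
    fun h h' => ⟨h.1.trans h'.1, h.2.trans h'.2⟩⟩
  refine (h.map (f := id) hE fun a b hab => hab.rel_of_root hE.refl ?_ ?_ hroot).2
  · rintro a b c ⟨h₁, -⟩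
    exact ⟨by simp only [arity, h₁], by simp only [mirror, spineArities, arity_mirror, h₁]⟩
  · rintro a b c ⟨h₁, h₂⟩
    exact ⟨by simp only [arity, h₁], by simp only [mirror, spineArities, h₂]⟩

theorem magCongr_one_two_iff (a b : BTree) :
    MagCongr 1 2 a b ↔ a.spineArities = b.spineArities := by
  refine rel_iff_spineArities_eq (CongrGen.equivalence _) (fun _ _ _ _ => CongrGen.node)
    (fun x y z w => Relation.EqvGen.rel _ _
      (Step.root (s := cubic 1) (s' := cubic 2) (And.intro rfl rfl) [x, y, z, w] rfl))
    (fun a b h => h.spineArities_eq ?_) a b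
  rintro _ _ rs ⟨rfl, rfl⟩ hlen
  obtain ⟨x, y, z, w, rfl⟩ := exists_four_of_length hlen
  simp [cubic, multigraft, arity, spineArities, Nat.add_assoc]

theorem magCongr_four_five_mirror_iff (a b : BTree) :
    MagCongr 4 5 a.mirror b.mirror ↔ a.spineArities = b.spineArities := by
  have hE : Equivalence fun a b : BTree => MagCongr 4 5 a.mirror b.mirror :=
    (CongrGen.equivalence _).comap mirror
  refine rel_iff_spineArities_eq hE (fun _ _ _ _ ha hb => CongrGen.node hb ha)
    (fun x y z w => Relation.EqvGen.symm _ _ (Relation.EqvGen.rel _ _ (Step.root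
      (s := cubic 4) (s' := cubic 5) (And.intro rfl rfl)
      [w.mirror, z.mirror, y.mirror, x.mirror] rfl))) (fun a b h => ?_) a b
  rw [← mirror_mirror a, ← mirror_mirror b]
  refine CongrGen.spineArities_mirror_eq ?_ h
  rintro _ _ rs ⟨rfl, rfl⟩ hlen
  obtain ⟨x, y, z, w, rfl⟩ := exists_four_of_length hlen
  simp [cubic, multigraft, mirror, arity, spineArities, Nat.add_comm, Nat.add_left_comm]

theorem classCount_eq_two_pow {E : BTree → BTree → Prop} {f : BTree → BTree}
    (hinvol : Function.Involutive f) (harity : ∀ t, (f t).arity = t.arity)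
    (hE : ∀ a b, E a b ↔ (f a).spineArities = (f b).spineArities) (n : ℕ) :
    classCount E (n + 1) = 2 ^ (n - 1) := by
  rw [classCount, ← composition_card n, ← Nat.card_eq_fintype_card]
  let g : {t : BTree // t.arity = n + 1} → Composition n := fun t =>
    ⟨(f t.1).spineArities, fun hk => spineArities_pos _ _ hk, by
      have h := spineArities_sum (f t.1)
      rw [harity, t.2] at h
      omega⟩
  refine Nat.card_eq_of_bijective
    (Quot.lift g fun a b h => Composition.ext ((hE _ _).1 h)) ⟨?_, fun c => ?_⟩
  · rintro ⟨a⟩ ⟨b⟩ h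
    exact Quot.sound ((hE _ _).2 (congrArg Composition.blocks h))
  · have hc := spineArities_ofSpineArities c.blocks fun _ hk => c.blocks_pos hk
    refine ⟨Quot.mk _ ⟨f (ofSpineArities c.blocks), ?_⟩, Composition.ext ?_⟩
    · rw [harity, ← spineArities_sum, hc, c.blocks_sum]
    · change (f (f (ofSpineArities c.blocks))).spineArities = c.blocks
      rw [hinvol, hc]

theorem one_sub_two_X_mul_mk {c : ℕ → ℕ} (hc : ∀ n, c (n + 1) = 2 ^ (n - 1)) :
    (1 - 2 * PowerSeries.X : PowerSeries ℤ) *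
        PowerSeries.mk (fun n : ℕ => if n = 0 then 0 else (c n : ℤ)) =
      PowerSeries.X * (1 - PowerSeries.X) := by
  rw [show ∀ F : PowerSeries ℤ, (1 - 2 * PowerSeries.X) * F =
    F - (PowerSeries.X * F + PowerSeries.X * F) by intro F; ring, mul_sub, mul_one, ← pow_two]
  ext n
  rcases n with _ | _ | _ | n
  · simp
  · simp [hc, PowerSeries.coeff_succ_X_mul, PowerSeries.coeff_X, PowerSeries.coeff_X_pow]
  · simp [hc, PowerSeries.coeff_succ_X_mul, PowerSeries.coeff_X, PowerSeries.coeff_X_pow]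
  · simp [hc, PowerSeries.coeff_succ_X_mul, PowerSeries.coeff_X, PowerSeries.coeff_X_pow]
    ring

/-- The Hilbert series of `Mag^{1,2}` and `Mag^{4,5}` both equal
`t (1 - t) / (1 - 2t)`. -/
theorem stmt13 :
    (1 - 2 * PowerSeries.X : PowerSeries ℤ) *
        PowerSeries.mk (fun n : ℕ => if n = 0 then 0 else (classCount (MagCongr 1 2) n : ℤ)) =
      PowerSeries.X * (1 - PowerSeries.X) ∧
    (1 - 2 * PowerSeries.X : PowerSeries ℤ) *
        PowerSeries.mk (fun n : ℕ => if n = 0 then 0 else (classCount (MagCongr 4 5) n : ℤ)) =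
      PowerSeries.X * (1 - PowerSeries.X) := by
  refine ⟨one_sub_two_X_mul_mk (classCount_eq_two_pow (f := id) (fun _ => rfl) (fun _ => rfl)
    magCongr_one_two_iff), one_sub_two_X_mul_mk (classCount_eq_two_pow (f := mirror)
    mirror_mirror arity_mirror fun a b => ?_)⟩
  rw [← magCongr_four_five_mirror_iff, mirror_mirror, mirror_mirror]
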